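/- Let c > 0, let T > 0, and let d : (0,T) → (0,∞) be such that t ↦ d_t² is continuously differentiable on (0,T). For z ∈ ℂ \ ℝ and t ∈ (0,T) define G_t(z) = ∫_ℝ μ_MP(c,1)(dx)/(z − d_t² x), where μ_MP(c,1) is the Marchenko–Pastur distribution with ratio c and scale 1. Then for all t ∈ (0,T) and z ∈ ℂ \ ℝ, ∂_t G_t(z) = −(d_t²)′ ( c G_t(z)² + 2cz G_t(z) ∂_z G_t(z) + (1 − c) ∂_z G_t(z) ). -/

import Mathlib

open MeasureTheory
open scoped Classical

/-- The Marchenko–Pastur distribution `μ_MP(c, 1)` with ratio `c > 0` and scale `1`: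
absolutely continuous part with density
`√((( 1+√c)² − x)(x − (1−√c)²)) / (2πcx)` on `[(1−√c)², (1+√c)²]`, plus an atom of mass
`1 − 1/c` at `0` when `c > 1`. -/
noncomputable def mpMeasure (c : ℝ) : Measure ℝ :=
  volume.withDensity (fun x => ENNReal.ofReal
    (if (1 - Real.sqrt c) ^ 2 ≤ x ∧ x ≤ (1 + Real.sqrt c) ^ 2 then
      Real.sqrt (((1 + Real.sqrt c) ^ 2 - x) * (x - (1 - Real.sqrt c) ^ 2)) /
        (2 * Real.pi * c * x)
    else 0))
  + (if 1 < c then ENNReal.ofReal (1 - 1 / c) • Measure.dirac (0 : ℝ) else 0)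

/-- The Stieltjes transform of the Marchenko–Pastur law `μ_MP(c,1)` scaled by `a`:
`G(z) = ∫ μ_MP(c,1)(dx) / (z − a x)`. -/
noncomputable def mpStieltjes (c : ℝ) (a : ℝ) (z : ℂ) : ℂ :=
  ∫ x, 1 / (z - (a : ℂ) * (x : ℂ)) ∂(mpMeasure c)

/-- Averaging a holomorphic function over conjugate pairs of points of the unit circle. -/
theorem DiffContOnCl.integral_circleMap_add_neg {h : ℂ → ℂ}
    (hh : DiffContOnCl ℂ h (Metric.ball 0 1)) :
    ∫ θ in (0:ℝ)..Real.pi, (h (circleMap 0 1 θ) + h (circleMap 0 1 (-θ))) =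
      2 * Real.pi * h 0 := by
  have hcont : Continuous fun θ : ℝ => h (circleMap 0 1 θ) := by
    refine hh.continuousOn_ball.comp_continuous (continuous_circleMap 0 1) fun θ => ?_
    simp [circleMap]
  have havg : (2 * Real.pi)⁻¹ • ∫ θ in (0:ℝ)..2 * Real.pi, h (circleMap 0 1 θ) = h 0 := by
    rw [← Real.circleAverage_def]
    exact DiffContOnCl.circleAverage (by simpa using hh)
  have hsecond : ∫ θ in (0:ℝ)..Real.pi, h (circleMap 0 1 (-θ)) =
      ∫ θ in Real.pi..2 * Real.pi, h (circleMap 0 1 θ) := by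
    have hsub := intervalIntegral.integral_comp_sub_left (a := 0) (b := Real.pi)
      (fun θ : ℝ => h (circleMap 0 1 θ)) (2 * Real.pi)
    rw [show 2 * Real.pi - Real.pi = Real.pi by ring, sub_zero] at hsub
    rw [← hsub]
    congr 1 with θ
    rw [sub_eq_neg_add, periodic_circleMap]
  have hneg : Continuous fun θ : ℝ => h (circleMap 0 1 (-θ)) := hcont.comp continuous_neg
  rw [intervalIntegral.integral_add (hcont.intervalIntegrable _ _)
    (hneg.intervalIntegrable _ _), hsecond,
    intervalIntegral.integral_add_adjacent_intervals (hcont.intervalIntegrable _ _)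
    (hcont.intervalIntegrable _ _), ← havg]
  have := Real.pi_ne_zero
  rw [Complex.real_smul]
  push_cast
  field_simp

theorem integral_sin_sq_div_of_norm_lt_one {u : ℂ} (hu : ‖u‖ < 1) :
    ∫ θ in (0:ℝ)..Real.pi,
      ((Real.sin θ ^ 2 : ℝ) : ℂ) / (1 - 2 * u * (Real.cos θ : ℂ) + u ^ 2) = (Real.pi / 2 : ℂ) := by
  have hne : ∀ ζ : ℂ, ‖ζ‖ ≤ 1 → 1 - u * ζ ≠ 0 := by
    intro ζ hζ h0
    have h1 : ‖u * ζ‖ = 1 := by rw [← sub_eq_zero.mp h0, norm_one]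
    rw [norm_mul] at h1
    nlinarith [norm_nonneg u, norm_nonneg ζ]
  have hh : DiffContOnCl ℂ (fun ζ : ℂ => (1 - ζ ^ 2) / (1 - u * ζ)) (Metric.ball 0 1) := by
    apply DifferentiableOn.diffContOnCl
    rw [closure_ball _ one_ne_zero]
    exact DifferentiableOn.div (by fun_prop) (by fun_prop) fun ζ hζ =>
      hne ζ (by simpa using hζ)
  have key := hh.integral_circleMap_add_neg
  have hpt : ∀ θ : ℝ, (1 - circleMap 0 1 θ ^ 2) / (1 - u * circleMap 0 1 θ) +
      (1 - circleMap 0 1 (-θ) ^ 2) / (1 - u * circleMap 0 1 (-θ)) =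
      4 * (((Real.sin θ ^ 2 : ℝ) : ℂ) / (1 - 2 * u * (Real.cos θ : ℂ) + u ^ 2)) := by
    intro θ
    have h1 := hne (circleMap 0 1 θ) (by simp)
    have h2 := hne (circleMap 0 1 (-θ)) (by simp)
    have e1 : circleMap 0 1 θ = Complex.cos θ + Complex.sin θ * Complex.I := by
      simp [circleMap, Complex.exp_mul_I]
    have e2 : circleMap 0 1 (-θ) = Complex.cos θ - Complex.sin θ * Complex.I := by
      simp only [circleMap, Complex.ofReal_one, one_mul, zero_add, Complex.ofReal_neg]
      rw [Complex.exp_mul_I, Complex.cos_neg, Complex.sin_neg]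
      ring
    have hsc := Complex.sin_sq_add_cos_sq (θ : ℂ)
    have hI := Complex.I_sq
    have hden : 1 - 2 * u * (Real.cos θ : ℂ) + u ^ 2 =
        (1 - u * circleMap 0 1 θ) * (1 - u * circleMap 0 1 (-θ)) := by
      rw [e1, e2]
      push_cast
      linear_combination (-u ^ 2) * hsc + u ^ 2 * Complex.sin θ ^ 2 * hI
    rw [hden, div_add_div _ _ h1 h2, ← mul_div_assoc]
    congr 1
    rw [e1, e2]
    push_cast
    generalize Complex.cos θ = C at *
    generalize Complex.sin θ = S at *
    have hC : C ^ 2 = 1 - S ^ 2 := by linear_combination hsc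
    ring_nf
    simp only [hI]
    have hC3 : C ^ 3 = C * (1 - S ^ 2) := by rw [← hC]; ring
    simp only [hC3, hC]
    ring
  simp only [hpt] at key
  rw [intervalIntegral.integral_const_mul] at key
  norm_num only [zero_pow, mul_zero, sub_zero, div_one, mul_one] at key
  linear_combination key / 4

theorem exists_norm_lt_one_add_inv_eq {w : ℂ} (hw : w.im ≠ 0) :
    ∃ u : ℂ, u ≠ 0 ∧ ‖u‖ < 1 ∧ u ^ 2 - 2 * w * u + 1 = 0 := by
  obtain ⟨s, hs⟩ := IsAlgClosed.exists_pow_nat_eq (w ^ 2 - 1) two_pos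
  have hprod : (w - s) * (w + s) = 1 := by linear_combination -hs
  have hnorm : ‖w - s‖ * ‖w + s‖ = 1 := by rw [← norm_mul, hprod, norm_one]
  rcases lt_trichotomy ‖w - s‖ 1 with h | h | h
  · exact ⟨w - s, left_ne_zero_of_mul_eq_one hprod, h, by linear_combination hs⟩
  · exfalso
    have hconj : (starRingEnd ℂ) (w - s) = w + s := by
      rw [← Complex.inv_eq_conj h]
      exact inv_eq_of_mul_eq_one_right hprod
    have h1 := congrArg Complex.im hconj
    simp at h1
    exact hw (by linarith)
  · refine ⟨w + s, right_ne_zero_of_mul_eq_one hprod, ?_, by linear_combination hs⟩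
    nlinarith [norm_nonneg (w + s)]

/-- The parametrisation `θ ↦ 1 + c + 2√c cos θ` of the bulk of the Marchenko–Pastur law. -/
noncomputable def mpParam (c θ : ℝ) : ℝ := 1 + c + 2 * √c * Real.cos θ

/-- The density of the absolutely continuous part of the Marchenko–Pastur law. -/
noncomputable def mpDensity (c x : ℝ) : ℝ :=
  if (1 - Real.sqrt c) ^ 2 ≤ x ∧ x ≤ (1 + Real.sqrt c) ^ 2 then
    Real.sqrt (((1 + Real.sqrt c) ^ 2 - x) * (x - (1 - Real.sqrt c) ^ 2)) /
      (2 * Real.pi * c * x)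
  else 0

theorem continuous_mpParam (c : ℝ) : Continuous (mpParam c) := by
  unfold mpParam; fun_prop

theorem mul_sin_sq_le_mpParam {c : ℝ} (hc : 0 < c) (θ : ℝ) :
    c * Real.sin θ ^ 2 ≤ mpParam c θ := by
  have h := Real.sq_sqrt hc.le
  have hs := Real.sin_sq_add_cos_sq θ
  unfold mpParam
  have : 1 + c + 2 * √c * Real.cos θ = (√c * Real.cos θ + 1) ^ 2 + c * Real.sin θ ^ 2 := by
    linear_combination c * (-hs) - Real.cos θ ^ 2 * h
  rw [this]
  nlinarith [sq_nonneg (√c * Real.cos θ + 1)]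

theorem mpParam_nonneg {c : ℝ} (hc : 0 < c) (θ : ℝ) : 0 ≤ mpParam c θ :=
  (by positivity : 0 ≤ c * Real.sin θ ^ 2).trans (mul_sin_sq_le_mpParam hc θ)

theorem mpDensity_nonneg {c : ℝ} (hc : 0 < c) (x : ℝ) : 0 ≤ mpDensity c x := by
  unfold mpDensity
  split_ifs with h
  · have : 0 ≤ x := (sq_nonneg _).trans h.1
    have := Real.pi_pos
    positivity
  · exact le_rfl

theorem measurable_mpDensity (c : ℝ) : Measurable (mpDensity c) := by
  unfold mpDensity
  refine Measurable.ite measurableSet_Icc ?_ measurable_const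
  fun_prop

theorem injOn_mpParam {c : ℝ} (hc : 0 < c) : Set.InjOn (mpParam c) (Set.Icc 0 Real.pi) := by
  intro x hx y hy hxy
  have : 0 < √c := Real.sqrt_pos.mpr hc
  refine Real.injOn_cos hx hy ?_
  unfold mpParam at hxy
  have h2 : 2 * √c * Real.cos x = 2 * √c * Real.cos y := by linarith
  exact mul_left_cancel₀ (by positivity) h2

theorem image_mpParam {c : ℝ} (hc : 0 < c) :
    mpParam c '' Set.Icc 0 Real.pi = Set.Icc ((1 - √c) ^ 2) ((1 + √c) ^ 2) := by
  have h := Real.sq_sqrt hc.le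
  have hs : 0 < √c := Real.sqrt_pos.mpr hc
  ext x
  constructor
  · rintro ⟨θ, -, rfl⟩
    unfold mpParam
    constructor <;> nlinarith [Real.cos_le_one θ, Real.neg_one_le_cos θ]
  · rintro ⟨h1, h2⟩
    obtain ⟨θ, hθ, hcos⟩ := Real.surjOn_cos (show (x - 1 - c) / (2 * √c) ∈ Set.Icc (-1) 1 by
      constructor
      · rw [le_div_iff₀ (by positivity)]; nlinarith
      · rw [div_le_iff₀ (by positivity)]; nlinarith)
    refine ⟨θ, hθ, ?_⟩
    unfold mpParam
    rw [hcos, mul_div_cancel₀ _ (by positivity : 2 * √c ≠ 0)]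
    ring

theorem hasDerivAt_mpParam (c θ : ℝ) :
    HasDerivAt (mpParam c) (-(2 * √c * Real.sin θ)) θ := by
  have := ((Real.hasDerivAt_cos θ).const_mul (2 * √c)).const_add (1 + c)
  exact this.congr_deriv (by ring)

theorem abs_deriv_mul_mpDensity_mpParam {c θ : ℝ} (hc : 0 < c) (hθ : θ ∈ Set.Icc 0 Real.pi) :
    |-(2 * √c * Real.sin θ)| * mpDensity c (mpParam c θ) =
      2 / Real.pi * (Real.sin θ ^ 2 / mpParam c θ) := by
  have hs : 0 < √c := Real.sqrt_pos.mpr hc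
  have hsin := Real.sin_nonneg_of_mem_Icc hθ
  have hmem : mpParam c θ ∈ Set.Icc ((1 - √c) ^ 2) ((1 + √c) ^ 2) := by
    rw [← image_mpParam hc]; exact Set.mem_image_of_mem _ hθ
  have hsq : ((1 + √c) ^ 2 - mpParam c θ) * (mpParam c θ - (1 - √c) ^ 2) =
      (2 * √c * Real.sin θ) ^ 2 := by
    have h := Real.sq_sqrt hc.le
    have hsc := Real.sin_sq_add_cos_sq θ
    have h1 : (1 + √c) ^ 2 - mpParam c θ = 2 * √c * (1 - Real.cos θ) := by
      unfold mpParam; linear_combination h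
    have h2 : mpParam c θ - (1 - √c) ^ 2 = 2 * √c * (1 + Real.cos θ) := by
      unfold mpParam; linear_combination -h
    rw [h1, h2]
    linear_combination -4 * √c ^ 2 * hsc
  rw [mpDensity, if_pos (Set.mem_Icc.mp hmem), hsq, Real.sqrt_sq (by positivity), abs_neg,
    abs_of_nonneg (by positivity)]
  have := Real.pi_pos
  rcases eq_or_ne (mpParam c θ) 0 with h0 | h0
  · simp [h0]
  · field_simp
    rw [Real.sq_sqrt hc.le]
    ring

theorem mpDensity_smul_eq_indicator (c : ℝ) (f : ℝ → ℂ) :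
    (fun x => mpDensity c x • f x) =
      (Set.Icc ((1 - √c) ^ 2) ((1 + √c) ^ 2)).indicator fun x => mpDensity c x • f x := by
  refine (Set.indicator_eq_self.mpr fun x hx => ?_).symm
  by_contra h
  refine hx ?_
  have : ¬((1 - √c) ^ 2 ≤ x ∧ x ≤ (1 + √c) ^ 2) := h
  simp [mpDensity, this]

theorem integral_mpDensity_smul {c : ℝ} (hc : 0 < c) (f : ℝ → ℂ) :
    ∫ x, mpDensity c x • f x =
      ∫ θ in (0:ℝ)..Real.pi,
        (2 / Real.pi * (Real.sin θ ^ 2 / mpParam c θ)) • f (mpParam c θ) := by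
  rw [mpDensity_smul_eq_indicator, integral_indicator measurableSet_Icc, ← image_mpParam hc,
    integral_image_eq_integral_abs_deriv_smul measurableSet_Icc
      (fun θ _ => (hasDerivAt_mpParam c θ).hasDerivWithinAt) (injOn_mpParam hc),
    intervalIntegral.integral_of_le Real.pi_pos.le, ← integral_Icc_eq_integral_Ioc]
  refine setIntegral_congr_fun measurableSet_Icc fun θ hθ => ?_
  rw [smul_smul, abs_deriv_mul_mpDensity_mpParam hc hθ]

theorem integrable_mpDensity_smul {c : ℝ} (hc : 0 < c) (f : ℝ → ℂ)
    (hf : IntegrableOn (fun θ =>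
      (2 / Real.pi * (Real.sin θ ^ 2 / mpParam c θ)) • f (mpParam c θ)) (Set.Icc 0 Real.pi)) :
    Integrable fun x => mpDensity c x • f x := by
  rw [mpDensity_smul_eq_indicator, integrable_indicator_iff measurableSet_Icc, ← image_mpParam hc,
    integrableOn_image_iff_integrableOn_abs_deriv_smul measurableSet_Icc
      (fun θ _ => (hasDerivAt_mpParam c θ).hasDerivWithinAt) (injOn_mpParam hc)]
  refine hf.congr_fun (fun θ hθ => ?_) measurableSet_Icc
  rw [smul_smul, abs_deriv_mul_mpDensity_mpParam hc hθ]

theorem integrableOn_sin_sq_div_mpParam {c : ℝ} (hc : 0 < c) :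
    IntegrableOn (fun θ => Real.sin θ ^ 2 / mpParam c θ) (Set.Icc 0 Real.pi) := by
  have hm := (continuous_mpParam c).measurable
  refine Measure.integrableOn_of_bounded (M := 1 / c) (by simp)
    (by fun_prop : Measurable _).aestronglyMeasurable (ae_of_all _ fun θ => ?_)
  have h0 := mpParam_nonneg hc θ
  rw [Real.norm_of_nonneg (by positivity)]
  refine div_le_of_le_mul₀ h0 (by positivity) ?_
  have := mul_sin_sq_le_mpParam hc θ
  rw [div_mul_eq_mul_div, le_div_iff₀ hc]
  linarith

theorem integral_sin_sq_div_mpParam {c : ℝ} (hc : 0 < c) :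
    ∫ θ in (0:ℝ)..Real.pi, Real.sin θ ^ 2 / mpParam c θ =
      Real.pi / 2 * (if 1 < c then 1 / c else 1) := by
  have hs : 0 < √c := Real.sqrt_pos.mpr hc
  have h := Real.sq_sqrt hc.le
  have real_version : ∀ q : ℝ, |q| < 1 → ∫ θ in (0:ℝ)..Real.pi,
      Real.sin θ ^ 2 / (1 - 2 * q * Real.cos θ + q ^ 2) = Real.pi / 2 := by
    intro q hq
    have := integral_sin_sq_div_of_norm_lt_one (u := (q : ℂ)) (by simpa using hq)
    have h2 : ∀ θ : ℝ, ((Real.sin θ ^ 2 : ℝ) : ℂ) / (1 - 2 * (q:ℂ) * (Real.cos θ : ℂ) + (q:ℂ) ^ 2) =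
        ((Real.sin θ ^ 2 / (1 - 2 * q * Real.cos θ + q ^ 2) : ℝ) : ℂ) := by
      intro θ; push_cast; rfl
    simp only [h2] at this
    rw [intervalIntegral.integral_ofReal] at this
    exact_mod_cast this
  rcases lt_trichotomy c 1 with h1 | rfl | h1
  · rw [if_neg h1.not_gt, mul_one, ← real_version (-√c) ?_]
    · congr 1 with θ
      congr 1
      unfold mpParam
      linear_combination -h
    · rw [abs_neg, abs_of_pos hs, Real.sqrt_lt' one_pos]
      linarith
  · have hpt : Set.EqOn (fun θ => Real.sin θ ^ 2 / mpParam 1 θ)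
        (fun θ => (1 - Real.cos θ) / 2) (Set.Ioo 0 Real.pi) := by
      intro θ hθ
      have hsin := Real.sin_pos_of_mem_Ioo hθ
      have hpos : 0 < mpParam 1 θ :=
        (by positivity : 0 < 1 * Real.sin θ ^ 2).trans_le (mul_sin_sq_le_mpParam one_pos θ)
      simp only
      rw [div_eq_iff hpos.ne']
      unfold mpParam
      rw [Real.sqrt_one]
      linear_combination Real.sin_sq_add_cos_sq θ
    rw [intervalIntegral.integral_of_le Real.pi_pos.le, integral_Ioc_eq_integral_Ioo,
      setIntegral_congr_fun measurableSet_Ioo hpt, ← integral_Ioc_eq_integral_Ioo,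
      ← intervalIntegral.integral_of_le Real.pi_pos.le]
    simp
  · rw [if_pos h1, ← real_version (-(√c)⁻¹) ?_, ← intervalIntegral.integral_mul_const]
    · congr 1 with θ
      rw [div_mul_div_comm, mul_one]
      congr 1
      unfold mpParam
      field_simp
      linear_combination (1 + 2 * √c * Real.cos θ) * h
    · rw [abs_neg, abs_of_pos (by positivity)]
      refine inv_lt_one_of_one_lt₀ ?_
      rw [Real.lt_sqrt zero_le_one]
      linarith

theorem sub_ofReal_ne_zero {z : ℂ} (hz : z.im ≠ 0) (x : ℝ) : z - (x : ℂ) ≠ 0 := by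
  intro h
  apply hz
  simpa using congrArg Complex.im h

/-- The integral `∫₀^π sin² θ / (z - (1 + c + 2√c cos θ)) dθ`. -/
noncomputable def mpAngular (c : ℝ) (z : ℂ) : ℂ :=
  ∫ θ in (0:ℝ)..Real.pi, ((Real.sin θ ^ 2 : ℝ) : ℂ) / (z - (mpParam c θ : ℂ))

theorem continuous_sin_sq_div_sub_mpParam (c : ℝ) {z : ℂ} (hz : z.im ≠ 0) :
    Continuous fun θ : ℝ => ((Real.sin θ ^ 2 : ℝ) : ℂ) / (z - (mpParam c θ : ℂ)) := by
  have := continuous_mpParam c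
  exact Continuous.div (by fun_prop) (by fun_prop) fun θ => sub_ofReal_ne_zero hz _

theorem mpStieltjes_one_eq {c : ℝ} (hc : 0 < c) {z : ℂ} (hz : z.im ≠ 0) :
    mpStieltjes c 1 z = (1 + 2 / Real.pi * mpAngular c z) / z := by
  have hz0 : z ≠ 0 := by rintro rfl; simp at hz
  have hpi : (Real.pi : ℂ) ≠ 0 := by exact_mod_cast Real.pi_ne_zero
  have hpt : ∀ θ : ℝ, (2 / Real.pi * (Real.sin θ ^ 2 / mpParam c θ)) •
      (1 / (z - (mpParam c θ : ℂ))) = (2 / Real.pi / z : ℂ) *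
      (((Real.sin θ ^ 2 / mpParam c θ : ℝ) : ℂ) +
        ((Real.sin θ ^ 2 : ℝ) : ℂ) / (z - (mpParam c θ : ℂ))) := by
    intro θ
    have hne := sub_ofReal_ne_zero hz (mpParam c θ)
    rw [Complex.real_smul]
    rcases eq_or_ne (mpParam c θ) 0 with h0 | h0
    · have h1 := mul_sin_sq_le_mpParam hc θ
      have h2 : Real.sin θ ^ 2 = 0 := by
        refine le_antisymm ?_ (sq_nonneg _)
        rw [h0] at h1
        exact nonpos_of_mul_nonpos_right h1 hc
      simp only [h0, h2]
      simp
    · have h0' : (mpParam c θ : ℂ) ≠ 0 := by exact_mod_cast h0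
      push_cast
      field_simp
      ring
  have hint1 : IntervalIntegrable (fun θ : ℝ => ((Real.sin θ ^ 2 / mpParam c θ : ℝ) : ℂ)) volume
      0 Real.pi := by
    rw [intervalIntegrable_iff_integrableOn_Icc_of_le Real.pi_pos.le]
    exact (integrableOn_sin_sq_div_mpParam hc).ofReal
  have hint2 : IntervalIntegrable (fun θ : ℝ => ((Real.sin θ ^ 2 : ℝ) : ℂ) /
      (z - (mpParam c θ : ℂ))) volume 0 Real.pi :=
    (continuous_sin_sq_div_sub_mpParam c hz).intervalIntegrable _ _
  have hac : ∫ x, mpDensity c x • (1 / (z - (x : ℂ))) =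
      ((if 1 < c then 1 / c else 1 : ℝ) + 2 / Real.pi * mpAngular c z) / z := by
    rw [integral_mpDensity_smul hc]
    simp only [hpt]
    rw [intervalIntegral.integral_const_mul, intervalIntegral.integral_add hint1 hint2,
      intervalIntegral.integral_ofReal, integral_sin_sq_div_mpParam hc, mpAngular]
    push_cast
    field_simp
  have hint : Integrable fun x => mpDensity c x • (1 / (z - (x : ℂ))) := by
    apply integrable_mpDensity_smul hc
    simp only [hpt]
    rw [← intervalIntegrable_iff_integrableOn_Icc_of_le Real.pi_pos.le]
    exact (hint1.add hint2).const_mul _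
  have hmeas : Measurable fun x => ENNReal.ofReal (mpDensity c x) :=
    (measurable_mpDensity c).ennreal_ofReal
  have hlt : ∀ᵐ x : ℝ, ENNReal.ofReal (mpDensity c x) < ⊤ :=
    ae_of_all _ fun x => ENNReal.ofReal_lt_top
  have hdef : mpMeasure c = volume.withDensity (fun x => ENNReal.ofReal (mpDensity c x)) +
      (if 1 < c then ENNReal.ofReal (1 - 1 / c) • Measure.dirac (0 : ℝ) else 0) := rfl
  have hwd : ∫ x, 1 / (z - (x : ℂ)) ∂(volume.withDensity fun x => ENNReal.ofReal (mpDensity c x)) =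
      ∫ x, mpDensity c x • (1 / (z - (x : ℂ))) := by
    rw [integral_withDensity_eq_integral_toReal_smul hmeas hlt]
    simp only [ENNReal.toReal_ofReal (mpDensity_nonneg hc _)]
  have hiwd : Integrable (fun x : ℝ => 1 / (z - (x : ℂ)))
      (volume.withDensity fun x => ENNReal.ofReal (mpDensity c x)) := by
    rw [integrable_withDensity_iff_integrable_smul' hmeas hlt]
    simpa only [ENNReal.toReal_ofReal (mpDensity_nonneg hc _)] using hint
  simp only [mpStieltjes, Complex.ofReal_one, one_mul]
  rw [hdef]
  split_ifs with h1
  · rw [integral_add_measure hiwd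
      ((integrable_dirac (by simp [enorm_lt_top])).smul_measure ENNReal.ofReal_ne_top), hwd, hac,
      if_pos h1, integral_smul_measure, integral_dirac, ENNReal.toReal_ofReal, Complex.real_smul]
    · have : (c : ℂ) ≠ 0 := by exact_mod_cast hc.ne'
      push_cast
      field_simp
      ring
    · rw [sub_nonneg, div_le_one hc]
      exact h1.le
  · rw [add_zero, hwd, hac, if_neg h1]
    simp

/-- The quadratic equation satisfied by the Stieltjes transform of the Marchenko–Pastur law. -/
theorem mpStieltjes_one_quadratic {c : ℝ} (hc : 0 < c) {z : ℂ} (hz : z.im ≠ 0) :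
    c * z * mpStieltjes c 1 z ^ 2 = mpStieltjes c 1 z * (z - (1 - c)) - 1 := by
  have hs : 0 < √c := Real.sqrt_pos.mpr hc
  have hs0 : (√c : ℂ) ≠ 0 := by exact_mod_cast hs.ne'
  have hsq : (√c : ℂ) ^ 2 = c := by exact_mod_cast Real.sq_sqrt hc.le
  have hz0 : z ≠ 0 := by rintro rfl; simp at hz
  have hpi : (Real.pi : ℂ) ≠ 0 := by exact_mod_cast Real.pi_ne_zero
  have him : ((z - (1 + c : ℝ)) / (2 * √c : ℝ)).im ≠ 0 := by
    rw [Complex.div_ofReal_im]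
    simpa [hs.ne'] using hz
  obtain ⟨u, hu0, hu1, hu⟩ := exists_norm_lt_one_add_inv_eq him
  have hzu : (z - 1 - c) * u = √c * (u ^ 2 + 1) := by
    push_cast at hu
    field_simp at hu
    linear_combination -hu
  have hang : mpAngular c z = u / √c * (Real.pi / 2) := by
    rw [mpAngular, ← integral_sin_sq_div_of_norm_lt_one hu1,
      ← intervalIntegral.integral_const_mul]
    congr 1 with θ
    have hden : z - (mpParam c θ : ℂ) =
        √c / u * (1 - 2 * u * (Real.cos θ : ℂ) + u ^ 2) := by
      unfold mpParam
      push_cast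
      field_simp
      linear_combination hzu
    rw [hden, ← div_div, div_div_eq_mul_div]
    ring
  rw [mpStieltjes_one_eq hc hz, hang]
  field_simp
  rw [← hsq] at hzu ⊢
  linear_combination -√c * hzu

theorem differentiableAt_mpAngular (c : ℝ) {z : ℂ} (hz : z.im ≠ 0) :
    DifferentiableAt ℂ (mpAngular c) z := by
  have hz' : 0 < |z.im| := abs_pos.mpr hz
  have him : ∀ w ∈ Metric.ball z (|z.im| / 2), |z.im| / 2 ≤ |w.im| := by
    intro w hw
    have h1 : |(w - z).im| ≤ ‖w - z‖ := Complex.abs_im_le_norm _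
    rw [mem_ball_iff_norm] at hw
    have h2 := abs_sub_abs_le_abs_sub z.im w.im
    rw [abs_sub_comm, ← Complex.sub_im] at h2
    linarith
  have hne : ∀ w ∈ Metric.ball z (|z.im| / 2), w.im ≠ 0 := fun w hw =>
    abs_pos.mp ((half_pos hz').trans_le (him w hw))
  have hball : Metric.ball z (|z.im| / 2) ∈ nhds z := Metric.ball_mem_nhds z (half_pos hz')
  have hp := continuous_mpParam c
  refine (intervalIntegral.hasDerivAt_integral_of_dominated_loc_of_deriv_le (μ := volume)
    (F' := fun w θ => -((Real.sin θ ^ 2 : ℝ) : ℂ) / (w - (mpParam c θ : ℂ)) ^ 2)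
    (bound := fun _ => 1 / (|z.im| / 2) ^ 2) hball ?_ ?_ ?_ ?_ ?_ ?_).2.differentiableAt
  · filter_upwards [hball] with w hw
    exact (continuous_sin_sq_div_sub_mpParam c (hne w hw)).aestronglyMeasurable
  · exact (continuous_sin_sq_div_sub_mpParam c hz).intervalIntegrable _ _
  · refine Continuous.aestronglyMeasurable (Continuous.div (by fun_prop) (by fun_prop) fun θ => ?_)
    exact pow_ne_zero 2 (sub_ofReal_ne_zero hz _)
  · refine ae_of_all _ fun θ _ w hw => ?_
    rw [norm_div, norm_neg, norm_pow, Complex.norm_real, Real.norm_of_nonneg (sq_nonneg _)]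
    have h1 : |z.im| / 2 ≤ ‖w - (mpParam c θ : ℂ)‖ := by
      refine (him w hw).trans ?_
      simpa using Complex.abs_im_le_norm (w - (mpParam c θ : ℂ))
    gcongr
    exact Real.sin_sq_le_one θ
  · exact intervalIntegrable_const
  · refine ae_of_all _ fun θ _ w hw => ?_
    have := (hasDerivAt_const w ((Real.sin θ ^ 2 : ℝ) : ℂ)).div
      ((hasDerivAt_id w).sub_const (mpParam c θ : ℂ)) (sub_ofReal_ne_zero (hne w hw) _)
    exact this.congr_deriv (by simp)

theorem eventually_im_ne_zero {z : ℂ} (hz : z.im ≠ 0) : ∀ᶠ w in nhds z, w.im ≠ 0 :=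
  Complex.continuous_im.continuousAt.eventually_ne hz

theorem differentiableAt_mpStieltjes_one {c : ℝ} (hc : 0 < c) {z : ℂ} (hz : z.im ≠ 0) :
    DifferentiableAt ℂ (mpStieltjes c 1) z := by
  have hz0 : z ≠ 0 := by rintro rfl; simp at hz
  have hang := differentiableAt_mpAngular c hz
  have : DifferentiableAt ℂ (fun w => (1 + 2 / Real.pi * mpAngular c w) / w) z :=
    ((hang.const_mul _).const_add _).div differentiableAt_id hz0
  refine this.congr_of_eventuallyEq ?_
  filter_upwards [eventually_im_ne_zero hz] with w hw
  exact mpStieltjes_one_eq hc hw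

/-- The derivative in `z` of the quadratic equation `mpStieltjes_one_quadratic`. -/
theorem mpStieltjes_one_deriv_quadratic {c : ℝ} (hc : 0 < c) {z g : ℂ} (hz : z.im ≠ 0)
    (hg : HasDerivAt (mpStieltjes c 1) g z) :
    c * mpStieltjes c 1 z ^ 2 + 2 * c * z * mpStieltjes c 1 z * g =
      g * (z - (1 - c)) + mpStieltjes c 1 z := by
  have hl := ((hasDerivAt_id z).const_mul (c : ℂ)).mul (hg.pow 2)
  have hr := (hg.mul ((hasDerivAt_id z).sub_const (1 - (c : ℂ)))).sub_const 1
  have heq := hl.unique (hr.congr_of_eventuallyEq (by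
    filter_upwards [eventually_im_ne_zero hz] with w hw
    simpa using mpStieltjes_one_quadratic hc hw))
  simp at heq
  linear_combination heq

theorem mpStieltjes_eq_div (c : ℝ) {a : ℝ} (ha : a ≠ 0) (z : ℂ) :
    mpStieltjes c a z = mpStieltjes c 1 (z / a) / a := by
  have ha' : (a : ℂ) ≠ 0 := by exact_mod_cast ha
  rw [mpStieltjes, mpStieltjes, ← integral_div]
  congr 1 with x
  rw [div_div, sub_mul, div_mul_cancel₀ _ ha', Complex.ofReal_one, one_mul, mul_comm (x : ℂ)]

/-- **Second PDE for the Stieltjes transform of the scaled Marchenko–Pastur law**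
(Remark 5.3 / eq. (5.8)): with `G_t(z) = ∫ μ_MP(c,1)(dx)/(z − d_t² x)` and `t ↦ d_t²`
continuously differentiable and positive on `(0,T)`, for `t ∈ (0,T)` and `z ∈ ℂ \ ℝ`,
`∂_t G_t(z) = −(d_t²)′ (c G_t(z)² + 2cz G_t(z) ∂_z G_t(z) + (1 − c) ∂_z G_t(z))`. -/
theorem mpStieltjes_pde_second_form
    (c : ℝ) (hc : 0 < c) (T : ℝ) (hT : 0 < T) (d : ℝ → ℝ)
    (hdpos : ∀ t ∈ Set.Ioo (0:ℝ) T, 0 < d t)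
    (hd2 : ContDiffOn ℝ 1 (fun t => d t ^ 2) (Set.Ioo (0:ℝ) T)) :
    ∀ t ∈ Set.Ioo (0:ℝ) T, ∀ z : ℂ, z.im ≠ 0 →
      ∃ gt gz : ℂ,
        HasDerivAt (fun s => mpStieltjes c (d s ^ 2) z) gt t ∧
        HasDerivAt (fun w => mpStieltjes c (d t ^ 2) w) gz z ∧
        gt = -(((deriv (fun s => d s ^ 2) t : ℝ)) : ℂ) *
          ((c : ℂ) * mpStieltjes c (d t ^ 2) z ^ 2 +
            2 * (c : ℂ) * z * mpStieltjes c (d t ^ 2) z * gz +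
            (1 - (c : ℂ)) * gz) := by
  intro t ht z hz
  have ha : 0 < d t ^ 2 := pow_pos (hdpos t ht) 2
  have ha' : ((d t ^ 2 : ℝ) : ℂ) ≠ 0 := by exact_mod_cast ha.ne'
  have hnhds : Set.Ioo (0:ℝ) T ∈ nhds t := Ioo_mem_nhds ht.1 ht.2
  have hd := ((hd2.contDiffAt hnhds).differentiableAt one_ne_zero).hasDerivAt.ofReal_comp
  have hw : (z / (d t ^ 2 : ℝ)).im ≠ 0 := by
    rw [Complex.div_ofReal_im]
    exact div_ne_zero hz ha.ne'
  have hg := (differentiableAt_mpStieltjes_one hc hw).hasDerivAt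
  have hquad := mpStieltjes_one_deriv_quadratic hc hw hg
  have hgt := (hg.scomp t ((hasDerivAt_const t z).div hd ha')).div hd ha'
  have hgz := (hg.comp z ((hasDerivAt_id z).div_const ((d t ^ 2 : ℝ) : ℂ))).div_const
    ((d t ^ 2 : ℝ) : ℂ)
  refine ⟨_, _, hgt.congr_of_eventuallyEq ?_, hgz.congr_of_eventuallyEq ?_, ?_⟩
  · filter_upwards [hnhds] with s hs
    exact mpStieltjes_eq_div c (pow_pos (hdpos s hs) 2).ne' z
  · exact Filter.Eventually.of_forall fun w => mpStieltjes_eq_div c ha.ne' w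
  · rw [mpStieltjes_eq_div c ha.ne' z]
    simp only [Function.comp_apply, smul_eq_mul]
    generalize deriv (mpStieltjes c 1) (z / (d t ^ 2 : ℝ)) = g at *
    generalize mpStieltjes c 1 (z / (d t ^ 2 : ℝ)) = G at *
    generalize ((d t ^ 2 : ℝ) : ℂ) = a at *
    generalize ((deriv (fun s => d s ^ 2) t : ℝ) : ℂ) = b at *
    field_simp at hquad ⊢
    linear_combination b * hquad
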